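/- arXiv:math/0201201 — 2 statements merged into one kernel-verified Lean document; each statement's English description precedes it below -/
import Mathlib

section
/- Let k be a finitely generated commutative ℂ-algebra, L and J unital finite type k-algebras, and φ: L → J a spectrum preserving k-linear algebra homomorphism. Assume that every simple left J-module has complex dimension at most n. Then for every primitive ideal P' of L, one has (φ*)⁻¹(P') = p⁻¹(Jac(J/Jφ(P')ⁿJ)), where Jφ(P')ⁿJ is the two-sided ideal of J generated by all products φ(a₁)φ(a₂)⋯φ(aₙ) with a₁,…,aₙ ∈ P', and p: J → J/Jφ(P')ⁿJ is the canonical projection. -/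
/-- A primitive ideal of a unital ring `A`: a (two-sided) ideal which is the
annihilator of a simple left `A`-module. -/
def IsPrimitiveIdeal (A : Type) [Ring A] (P : Ideal A) : Prop :=
  ∃ (V : Type) (_ : AddCommGroup V) (_ : Module A V),
    IsSimpleModule A V ∧ P = Module.annihilator A V

/-- The primitive ideal spectrum of a unital ring. -/
def PrimSpec (A : Type) [Ring A] : Type := {P : Ideal A // IsPrimitiveIdeal A P}

/-- The Jacobson radical: the intersection of all primitive ideals. -/
def jacRad (A : Type) [Ring A] : Ideal A := sInf {P : Ideal A | IsPrimitiveIdeal A P}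

section SpectrumPreservingDefs
variable {k L J : Type} [CommRing k] [Ring L] [Ring J] [Algebra k L] [Algebra k J]

/-- `f` realizes the relation `R_φ = {(P', P) : φ⁻¹(P') ⊆ P}` as the graph of a
bijection `Prim(J) → Prim(L)`. -/
def IsGraphOf (φ : L →ₙₐ[k] J) (f : PrimSpec J → PrimSpec L) : Prop :=
  Function.Bijective f ∧
    ∀ (P : PrimSpec J) (Q : PrimSpec L),
      ((⇑φ) ⁻¹' (P.1 : Set J) ⊆ (Q.1 : Set L)) ↔ f P = Q

/-- A `k`-linear (not necessarily unital) algebra morphism of unital `k`-algebras is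
spectrum preserving iff `R_φ` is the graph of a bijection `Prim(J) → Prim(L)`. -/
def SpectrumPreserving (φ : L →ₙₐ[k] J) : Prop := ∃ f, IsGraphOf φ f

end SpectrumPreservingDefs

/-- The two-sided ideal `J φ(T)ⁿ J` of `J` generated by all products
`φ(a₁) ⋯ φ(aₙ)` with `a₁, …, aₙ ∈ T` (realized as the left ideal generated by the
right multiples of such products). -/
def prodIdeal {k L J : Type} [CommRing k] [Ring L] [Ring J] [Algebra k L] [Algebra k J]
    (φ : L →ₙₐ[k] J) (n : ℕ) (T : Set L) : Ideal J :=
  Ideal.span {y : J | ∃ a : Fin n → L, (∀ i, a i ∈ T) ∧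
    ∃ c : J, y = (List.ofFn fun i => φ (a i)).prod * c}

/-- If an ideal annihilates every simple module whose annihilator contains that of `W`, then
products of at least `length W` elements of it annihilate `W`. -/
lemma list_prod_smul_eq_zero_of_length_le {A : Type} [Ring A] (T : Set A) (l : List A)
    (hl : ∀ a ∈ l, a ∈ T) {W : Type} [AddCommGroup W] [Module A W]
    (hlen : Module.length A W ≤ l.length)
    (hT : ∀ (S : Type) [AddCommGroup S] [Module A S] [IsSimpleModule A S],
      Module.annihilator A W ≤ Module.annihilator A S →
        T ⊆ (Module.annihilator A S : Set A))
    (w : W) : l.prod • w = 0 := by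
  induction l generalizing W with
  | nil =>
    have : Subsingleton W := Module.length_eq_zero_iff.mp (by simpa using hlen)
    exact Subsingleton.elim _ _
  | cons a l ih =>
    rcases subsingleton_or_nontrivial W with h | h
    · exact Subsingleton.elim _ _
    have hfin : IsFiniteLength A W :=
      Module.length_ne_top_iff.mp (ne_top_of_le_ne_top (by simp) hlen)
    have : IsArtinian A W := (isFiniteLength_iff_isNoetherian_isArtinian.mp hfin).2
    obtain ⟨S, hS⟩ := IsAtomic.exists_atom (Submodule A W)
    have hSs : IsSimpleModule A S := isSimpleModule_iff_isAtom.mpr hS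
    have hq : Module.length A (W ⧸ S) ≤ l.length := by
      have h1 := Module.length_eq_add_of_exact S.subtype S.mkQ S.subtype_injective
        S.mkQ_surjective (LinearMap.exact_subtype_mkQ S)
      have h2 : Module.length A S = 1 := Module.length_eq_one_iff.mpr hSs
      rw [h1, h2, List.length_cons, Nat.cast_add, Nat.cast_one, add_comm] at hlen
      exact (ENat.add_le_add_iff_right (by simp)).mp hlen
    have hmem : l.prod • w ∈ S := by
      rw [← Submodule.Quotient.mk_eq_zero, Submodule.Quotient.mk_smul]
      refine ih (fun b hb => hl b (List.mem_cons_of_mem _ hb)) hq (fun S' _ _ _ h' => hT S' ?_) _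
      exact (LinearMap.annihilator_le_of_surjective S.mkQ S.mkQ_surjective).trans h'
    have ha := hT S (LinearMap.annihilator_le_of_injective S.subtype S.subtype_injective)
      (hl a List.mem_cons_self)
    have := Module.mem_annihilator.mp ha ⟨_, hmem⟩
    rw [List.prod_cons, mul_smul]
    exact congrArg Subtype.val this

/-- A two-sided ideal that does not annihilate a simple module contains, for every `n`, elements
`a₁, …, aₙ` whose product does not annihilate it. -/
lemma exists_prod_smul_ne_zero {A : Type} [Ring A] (I : Ideal A) [I.IsTwoSided]
    (S : Type) [AddCommGroup S] [Module A S] [IsSimpleModule A S]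
    (hI : ¬ I ≤ Module.annihilator A S) (n : ℕ) :
    ∃ a : Fin n → A, (∀ i, a i ∈ I) ∧ ∃ s : S, (List.ofFn a).prod • s ≠ 0 := by
  obtain ⟨b, hb, hb'⟩ := Set.not_subset.mp hI
  obtain ⟨t, ht⟩ : ∃ t : S, b • t ≠ 0 := by
    by_contra! h
    exact hb' (Module.mem_annihilator.mpr h)
  have key : ∀ s : S, s ≠ 0 → ∃ a ∈ I, a • s ≠ 0 := fun s hs => by
    obtain ⟨c, hc⟩ := IsSimpleModule.toSpanSingleton_surjective A hs t
    refine ⟨b * c, I.mul_mem_right c hb, ?_⟩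
    rw [mul_smul]
    rw [LinearMap.toSpanSingleton_apply] at hc
    rwa [hc]
  induction n with
  | zero =>
    refine ⟨Fin.elim0, fun i => i.elim0, t, ?_⟩
    rintro h
    simp at h
    exact ht (by rw [h, smul_zero])
  | succ n ih =>
    obtain ⟨a, ha, s, hs⟩ := ih
    obtain ⟨c, hc, hcs⟩ := key _ hs
    refine ⟨Fin.cons c a, Fin.cases hc ha, s, ?_⟩
    simpa [List.ofFn_succ, mul_smul] using hcs

lemma NonUnitalAlgHom.map_list_prod {k L J : Type} [CommRing k] [Ring L] [Ring J]
    [Algebra k L] [Algebra k J] (φ : L →ₙₐ[k] J) {l : List L} (hl : l ≠ []) :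
    φ l.prod = (l.map φ).prod := by
  induction l with
  | nil => exact absurd rfl hl
  | cons a l ih =>
    rcases eq_or_ne l [] with rfl | h
    · simp
    · rw [List.map_cons, List.prod_cons, List.prod_cons, map_mul, ih h]

/-- The largest subgroup of a `J`-module on which `φ : L → J` acts unitally. -/
def unitalPart {k L J : Type} [CommRing k] [Ring L] [Ring J] [Algebra k L] [Algebra k J]
    (φ : L →ₙₐ[k] J) (V : Type) [AddCommGroup V] [Module J V] : AddSubgroup V where
  carrier := {v | φ 1 • v = v}
  zero_mem' := smul_zero _
  add_mem' {x y} hx hy := by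
    simp only [Set.mem_ofPred_eq] at *
    rw [smul_add, hx, hy]
  neg_mem' {x} hx := by
    simp only [Set.mem_ofPred_eq] at *
    rw [smul_neg, hx]

lemma smul_mem_unitalPart {k L J : Type} [CommRing k] [Ring L] [Ring J] [Algebra k L]
    [Algebra k J] (φ : L →ₙₐ[k] J) {V : Type} [AddCommGroup V] [Module J V] (a : L) (v : V) :
    φ a • v ∈ unitalPart φ V := by
  change φ 1 • φ a • v = φ a • v
  rw [← mul_smul, ← map_mul, one_mul]

instance unitalPartModule {k L J : Type} [CommRing k] [Ring L] [Ring J] [Algebra k L]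
    [Algebra k J] (φ : L →ₙₐ[k] J) (V : Type) [AddCommGroup V] [Module J V] :
    Module L (unitalPart φ V) where
  smul a v := ⟨φ a • (v : V), smul_mem_unitalPart φ a (v : V)⟩
  one_smul v := Subtype.ext v.2
  mul_smul a b v := Subtype.ext (by
    change φ (a * b) • (v : V) = φ a • φ b • (v : V)
    rw [map_mul, mul_smul])
  smul_zero a := Subtype.ext (by
    change φ a • (0 : V) = 0
    rw [smul_zero])
  smul_add a v w := Subtype.ext (by
    change φ a • ((v : V) + (w : V)) = φ a • (v : V) + φ a • (w : V)
    rw [smul_add])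
  add_smul a b v := Subtype.ext (by
    change φ (a + b) • (v : V) = φ a • (v : V) + φ b • (v : V)
    rw [map_add, add_smul])
  zero_smul v := Subtype.ext (by
    change φ 0 • (v : V) = 0
    rw [map_zero, zero_smul])

lemma coe_smul_unitalPart {k L J : Type} [CommRing k] [Ring L] [Ring J] [Algebra k L]
    [Algebra k J] (φ : L →ₙₐ[k] J) {V : Type} [AddCommGroup V] [Module J V] (a : L)
    (v : unitalPart φ V) : ((a • v : unitalPart φ V) : V) = φ a • (v : V) := rfl

lemma length_unitalPart_le {k L J : Type} [CommRing k] [Algebra ℂ k] [Ring L] [Ring J]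
    [Algebra k L] [Algebra k J] [Algebra ℂ J] [IsScalarTower ℂ k J]
    (φ : L →ₙₐ[k] J) (V : Type) [AddCommGroup V] [Module J V] (n : ℕ)
    (h : letI : Module ℂ V := Module.compHom V (algebraMap ℂ J)
      Module.rank ℂ V ≤ (n : Cardinal)) :
    Module.length L (unitalPart φ V) ≤ n := by
  let _ : Module ℂ V := Module.compHom V (algebraMap ℂ J)
  change Module.rank ℂ V ≤ (n : Cardinal) at h
  have : Module.Finite ℂ V := Module.rank_lt_aleph0_iff.mp
    (h.trans_lt (Cardinal.natCast_lt_aleph0))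
  have hsmul : ∀ (c : ℂ) (v : unitalPart φ V),
      c • (v : V) = ((algebraMap k L (algebraMap ℂ k c) • v : unitalPart φ V) : V) := by
    intro c v
    rw [coe_smul_unitalPart, Algebra.algebraMap_eq_smul_one, map_smul, Algebra.smul_def,
      mul_smul, v.2, ← IsScalarTower.algebraMap_apply]
    rfl
  let F : Submodule L (unitalPart φ V) → Submodule ℂ V := fun N =>
    { N.toAddSubmonoid.map (unitalPart φ V).subtype with
      smul_mem' := by
        rintro c _ ⟨v, hv, rfl⟩
        exact ⟨_, N.smul_mem _ hv, (hsmul c v).symm⟩ }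
  have hF : ∀ N (v : unitalPart φ V), (v : V) ∈ F N ↔ v ∈ N := fun N v =>
    ⟨fun ⟨w, hw, hwv⟩ => by rwa [← Subtype.ext hwv], fun hv => ⟨v, hv, rfl⟩⟩
  have hmono : StrictMono F := by
    refine Monotone.strictMono_of_injective ?_ ?_
    · rintro N N' hN _ ⟨v, hv, rfl⟩
      exact ⟨v, hN hv, rfl⟩
    · intro N N' hN
      ext v
      rw [← hF N, ← hF N', hN]
  have h1 : Module.length L (unitalPart φ V) ≤ Module.length ℂ V := by
    rw [← WithBot.coe_le_coe, Module.coe_length, Module.coe_length]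
    exact Order.krullDim_le_of_strictMono F hmono
  refine h1.trans ?_
  rw [Module.length_eq_finrank]
  exact_mod_cast Module.finrank_le_of_rank_le h

/-- If `Prim(J) → Prim(L)` is the bijection induced by `φ`, then `J φ(f P)ⁿ J ⊆ P` as soon as
simple `J`-modules have dimension at most `n`. -/
lemma prodIdeal_le_of_isGraphOf {k L J : Type} [CommRing k] [Algebra ℂ k] [Ring L] [Ring J]
    [Algebra k L] [Algebra k J] [Algebra ℂ J] [IsScalarTower ℂ k J]
    {φ : L →ₙₐ[k] J} {f : PrimSpec J → PrimSpec L} (hf : IsGraphOf φ f) {n : ℕ} (hn : n ≠ 0)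
    (hdim : ∀ (V : Type) (_ : AddCommGroup V) (_ : Module J V),
      IsSimpleModule J V →
        letI : Module ℂ V := Module.compHom V (algebraMap ℂ J)
        Module.rank ℂ V ≤ (n : Cardinal))
    (P : PrimSpec J) : prodIdeal φ n ((f P).1 : Set L) ≤ P.1 := by
  obtain ⟨V, _, _, hV, hPV⟩ := P.2
  obtain ⟨m, rfl⟩ := Nat.exists_eq_succ_of_ne_zero hn
  refine Ideal.span_le.mpr ?_
  rintro _ ⟨a, ha, c, rfl⟩
  rw [SetLike.mem_coe, hPV, Module.mem_annihilator]
  intro v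
  have hker : ∀ w : unitalPart φ V, (List.ofFn a).prod • w = 0 := by
    refine list_prod_smul_eq_zero_of_length_le ((f P).1 : Set L) _
      (by
        simp only [List.mem_ofFn]
        rintro _ ⟨i, rfl⟩
        exact ha i) (by
        rw [List.length_ofFn]
        exact length_unitalPart_le φ V _ (hdim V _ _ hV)) ?_
    intro S _ _ _ hS
    have hprim : IsPrimitiveIdeal L (Module.annihilator L S) :=
      ⟨S, inferInstance, inferInstance, inferInstance, rfl⟩
    have hfP : f P = ⟨Module.annihilator L S, hprim⟩ := by
      refine (hf.2 P ⟨_, hprim⟩).mp ?_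
      intro x hx
      refine hS (Module.mem_annihilator.mpr fun w => Subtype.ext ?_)
      rw [Set.mem_preimage, hPV] at hx
      exact Module.mem_annihilator.mp hx w
    rw [hfP]
  have hprod : (List.ofFn fun i => φ (a i)).prod = φ (List.ofFn a).prod := by
    rw [NonUnitalAlgHom.map_list_prod φ (by simp), List.map_ofFn]
    rfl
  rw [mul_smul, hprod, ← mul_one (List.ofFn a).prod, map_mul, mul_smul]
  exact congrArg Subtype.val (hker ⟨_, smul_mem_unitalPart φ 1 (c • v)⟩)

/-- A primitive ideal `Q` containing `J φ(f P)ⁿ J` is equal to `P`. -/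
lemma eq_of_prodIdeal_le {k L J : Type} [CommRing k] [Ring L] [Ring J]
    [Algebra k L] [Algebra k J] {φ : L →ₙₐ[k] J} {f : PrimSpec J → PrimSpec L}
    (hf : IsGraphOf φ f) {n : ℕ} (hn : n ≠ 0) {P Q : PrimSpec J}
    (hPQ : prodIdeal φ n ((f P).1 : Set L) ≤ Q.1) : P = Q := by
  apply hf.1.1
  rw [← hf.2]
  refine ((hf.2 P _).mpr rfl).trans ?_
  obtain ⟨S, _, _, hS, hQS⟩ := (f Q).2
  obtain ⟨W, _, _, -, hPW⟩ := (f P).2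
  rw [hQS]
  by_contra hle
  have : (f P).1.IsTwoSided := hPW ▸ inferInstance
  obtain ⟨a, ha, s, hs⟩ := exists_prod_smul_ne_zero (f P).1 S hle n
  refine hs (Module.mem_annihilator.mp ?_ s)
  rw [← hQS]
  refine (hf.2 Q _).mpr rfl (?_ : φ _ ∈ Q.1)
  refine hPQ (Ideal.subset_span ⟨a, ha, 1, ?_⟩)
  rw [mul_one, NonUnitalAlgHom.map_list_prod φ (by simpa using hn), List.map_ofFn]
  rfl

/-- The preimage of a primitive ideal under a surjection is primitive. -/
lemma IsPrimitiveIdeal.comap {A B : Type} [Ring A] [Ring B] (p : A →+* B)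
    (hp : Function.Surjective p) {R : Ideal B} (hR : IsPrimitiveIdeal B R) :
    IsPrimitiveIdeal A (R.comap p) := by
  obtain ⟨V, _, _, hV, rfl⟩ := hR
  let _ : Module A V := Module.compHom V p
  have : RingHomSurjective p := ⟨hp⟩
  let l : V →ₛₗ[p] V := { AddMonoidHom.id V with map_smul' := fun _ _ => rfl }
  refine ⟨V, inferInstance, inferInstance,
    (LinearMap.isSimpleModule_iff_of_bijective l Function.bijective_id).mpr hV, ?_⟩
  ext x
  rw [Ideal.mem_comap, Module.mem_annihilator, Module.mem_annihilator]
  rfl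

/-- A primitive ideal containing the kernel of a surjection comes from a primitive ideal. -/
lemma IsPrimitiveIdeal.exists_comap_eq {A B : Type} [Ring A] [Ring B] (p : A →+* B)
    (hp : Function.Surjective p) {P : Ideal A} (hP : IsPrimitiveIdeal A P)
    (hker : ∀ x, p x = 0 → x ∈ P) : ∃ R, IsPrimitiveIdeal B R ∧ R.comap p = P := by
  obtain ⟨V, _, _, hV, rfl⟩ := hP
  let g : A →+* AddMonoid.End V := Module.toAddMonoidEnd A V
  have hg : RingHom.ker p ≤ RingHom.ker g := fun x hx =>
    AddMonoidHom.ext fun v => Module.mem_annihilator.mp (hker x hx) v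
  let _ : Module B V := Module.compHom V (p.liftOfSurjective hp ⟨g, hg⟩)
  have hsmul : ∀ (x : A) (v : V), p x • v = x • v := fun x v =>
    DFunLike.congr_fun (p.liftOfSurjective_comp_apply hp ⟨g, hg⟩ x) v
  have : RingHomSurjective p := ⟨hp⟩
  let l : V →ₛₗ[p] V := { AddMonoidHom.id V with map_smul' := fun x v => (hsmul x v).symm }
  refine ⟨Module.annihilator B V, ⟨V, inferInstance, inferInstance,
    (LinearMap.isSimpleModule_iff_of_bijective l Function.bijective_id).mp hV, rfl⟩, ?_⟩
  ext x
  simp [Ideal.mem_comap, Module.mem_annihilator, hsmul]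

/-- For a spectrum preserving `φ : L → J` with induced bijection `φ* = f`, if all
simple left `J`-modules have complex dimension `≤ n` then, for every primitive ideal
`P'` of `L`, the primitive ideal `(φ*)⁻¹(P')` of `J` is the preimage under the
projection `p : J → J/Jφ(P')ⁿJ` of the Jacobson radical of `J/Jφ(P')ⁿJ` (the quotient
being presented as a surjective image of `J` with kernel `Jφ(P')ⁿJ`). -/
theorem inverse_bijection_via_jacobson_radical
    (k : Type) [CommRing k] [Algebra ℂ k] [Algebra.FiniteType ℂ k]
    (L J : Type) [Ring L] [Ring J] [Algebra k L] [Algebra k J]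
    [Module.Finite k L] [Module.Finite k J]
    [Algebra ℂ J] [IsScalarTower ℂ k J]
    (φ : L →ₙₐ[k] J) (f : PrimSpec J → PrimSpec L) (hf : IsGraphOf φ f)
    (n : ℕ)
    (hdim : ∀ (V : Type) (_ : AddCommGroup V) (_ : Module J V),
      IsSimpleModule J V →
        letI : Module ℂ V := Module.compHom V (algebraMap ℂ J)
        Module.rank ℂ V ≤ (n : Cardinal))
    (P' : PrimSpec L) (P : PrimSpec J) (hP : f P = P')
    (J₂ : Type) [Ring J₂] [Algebra k J₂] (p : J →ₐ[k] J₂)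
    (hp : Function.Surjective p)
    (hker : ∀ y : J, p y = 0 ↔ y ∈ prodIdeal φ n (P'.1 : Set L)) :
    (P.1 : Set J) = ⇑p ⁻¹' (jacRad J₂ : Set J₂) := by
  subst hP
  have hn : n ≠ 0 := by
    rintro rfl
    obtain ⟨V, _, _, hV, -⟩ := P.2
    have h := hdim V _ _ hV
    let _ : Module ℂ V := Module.compHom V (algebraMap ℂ J)
    have := IsSimpleModule.nontrivial J V
    exact not_subsingleton V (rank_zero_iff.mp (le_antisymm (by simpa using h) zero_le))
  have hcomap : ∀ R, IsPrimitiveIdeal J₂ R → R.comap p.toRingHom = P.1 := fun R hR => by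
    have hQ := hR.comap p.toRingHom hp
    refine congrArg Subtype.val (eq_of_prodIdeal_le hf hn (P := P) (Q := ⟨_, hQ⟩) ?_).symm
    intro y hy
    change p y ∈ R
    rw [(hker y).mpr hy]
    exact R.zero_mem
  obtain ⟨R, hR, hRP⟩ := P.2.exists_comap_eq p.toRingHom hp fun x hx =>
    prodIdeal_le_of_isGraphOf hf hn hdim P ((hker x).mp hx)
  ext x
  rw [Set.mem_preimage, SetLike.mem_coe, SetLike.mem_coe, jacRad, Submodule.mem_sInf]
  constructor
  · intro hx R' hR'
    rw [← hcomap R' hR'] at hx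
    exact hx
  · intro hx
    rw [← hRP]
    exact hx R hR
end

section
/- Let k be a finitely generated commutative ℂ-algebra, L and J unital finite type k-algebras, and φ: L → J a weakly spectrum preserving k-linear algebra homomorphism; that is, there exist increasing filtrations (0) = L₀ ⊆ L₁ ⊆ … ⊆ Lₙ = L and (0) = J₀ ⊆ J₁ ⊆ … ⊆ Jₙ = J by two-sided ideals such that φ(Lₖ) ⊆ Jₖ for all k and each induced morphism Lₖ/Lₖ₋₁ → Jₖ/Jₖ₋₁ is spectrum preserving. Then there exists a bijection between the set Prim(J) of primitive ideals of J and the set Prim(L) of primitive ideals of L. -/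
section NonUnitalDefs
variable (k : Type) {A B : Type} [CommRing k]
  [NonUnitalRing A] [Module k A] [IsScalarTower k A A] [SMulCommClass k A A]
  [NonUnitalRing B] [Module k B] [IsScalarTower k B B] [SMulCommClass k B B]

/-- The unital morphism `Unitization k A →ₐ[k] Unitization k B` induced by `φ : A →ₙₐ[k] B`. -/
noncomputable def unitizationMap (φ : A →ₙₐ[k] B) :
    Unitization k A →ₐ[k] Unitization k B :=
  Unitization.lift ((Unitization.inrNonUnitalAlgHom k B).comp φ)

/-- A morphism of possibly nonunital algebras is spectrum preserving iff the induced
morphism of unitizations is spectrum preserving. -/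
def NUSpectrumPreserving (φ : A →ₙₐ[k] B) : Prop :=
  SpectrumPreserving (unitizationMap k φ).toNonUnitalAlgHom

end NonUnitalDefs

/-- A simple module on which a two-sided ideal `K` acts nontrivially is already simple over `K`. -/
theorem exists_mem_smul_eq {A V : Type} [Ring A] [AddCommGroup V] [Module A V]
    [IsSimpleModule A V] (K : AddSubgroup A)
    (hl : ∀ x ∈ K, ∀ a : A, a * x ∈ K) (hr : ∀ x ∈ K, ∀ a : A, x * a ∈ K)
    (hK : ∃ x ∈ K, ∃ v : V, x • v ≠ 0) {v : V} (hv : v ≠ 0) (w : V) :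
    ∃ x ∈ K, x • v = w := by
  let N : Submodule A V :=
    { carrier := {u | ∀ x ∈ K, x • u = 0}
      add_mem' := fun ha hb x hx => by rw [smul_add, ha x hx, hb x hx, add_zero]
      zero_mem' := fun x _ => smul_zero x
      smul_mem' := fun a u hu x hx => by rw [← mul_smul]; exact hu _ (hr x hx a) }
  let M : Submodule A V :=
    { carrier := {u | ∃ x ∈ K, x • v = u}
      add_mem' := by
        rintro _ _ ⟨x, hx, rfl⟩ ⟨y, hy, rfl⟩
        exact ⟨x + y, K.add_mem hx hy, add_smul x y v⟩
      zero_mem' := ⟨0, K.zero_mem, zero_smul A v⟩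
      smul_mem' := by
        rintro a _ ⟨x, hx, rfl⟩
        exact ⟨a * x, hl x hx a, mul_smul a x v⟩ }
  have hN : N = ⊥ := by
    refine (eq_bot_or_eq_top N).resolve_right fun h => ?_
    obtain ⟨x, hx, u, hu⟩ := hK
    have hmem : u ∈ N := h ▸ Submodule.mem_top
    exact hu (hmem x hx)
  have hM : M = ⊤ := by
    refine (eq_bot_or_eq_top M).resolve_left fun h => hv ?_
    have hmem : v ∈ N := fun x hx => by
      have hxM : x • v ∈ M := ⟨x, hx, rfl⟩
      rwa [h, Submodule.mem_bot] at hxM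
    rwa [hN, Submodule.mem_bot] at hmem
  have hw : w ∈ M := hM ▸ Submodule.mem_top
  exact hw

/-- The kernel of a ring homomorphism to `AddMonoid.End V` acting transitively on nonzero vectors
is a primitive ideal. -/
theorem exists_primSpec_of_transitive {A V : Type} [Ring A] [AddCommGroup V] [Nontrivial V]
    (ρ : A →+* AddMonoid.End V) (hρ : ∀ v : V, v ≠ 0 → ∀ w, ∃ a, ρ a v = w) :
    ∃ P : PrimSpec A, ∀ a, a ∈ P.1 ↔ ∀ v, ρ a v = 0 := by
  let _ : Module A V := Module.compHom V ρ
  have hsimple : IsSimpleModule A V := by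
    refine isSimpleModule_iff_toSpanSingleton_surjective.mpr ⟨inferInstance, fun v hv w => ?_⟩
    exact hρ v hv w
  exact ⟨⟨Module.annihilator A V, V, inferInstance, inferInstance, hsimple, rfl⟩,
    fun a => Module.mem_annihilator⟩

theorem PrimSpec.exists_simple {A : Type} [Ring A] (P : PrimSpec A) :
    ∃ (V : Type) (_ : AddCommGroup V) (_ : Module A V), IsSimpleModule A V ∧
      ∀ a, a ∈ P.1 ↔ ∀ v : V, a • v = 0 := by
  obtain ⟨P, V, _, _, hV, rfl⟩ := P
  exact ⟨V, _, _, hV, fun a => Module.mem_annihilator⟩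

theorem PrimSpec.one_notMem {A : Type} [Ring A] (P : PrimSpec A) : (1 : A) ∉ P.1 := by
  obtain ⟨V, _, _, hV, hP⟩ := P.exists_simple
  have := IsSimpleModule.nontrivial A V
  obtain ⟨v, hv⟩ := exists_ne (0 : V)
  exact fun h => hv (by simpa using (hP 1).1 h v)

/-- A primitive ideal not containing the two-sided ideal `K` is determined by its trace on `K`. -/
theorem PrimSpec.mem_iff_forall_mul_mem {A : Type} [Ring A] (P : PrimSpec A) (K : AddSubgroup A)
    (hl : ∀ x ∈ K, ∀ a : A, a * x ∈ K) (hr : ∀ x ∈ K, ∀ a : A, x * a ∈ K)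
    (hK : ∃ x ∈ K, x ∉ P.1) (a : A) : a ∈ P.1 ↔ ∀ x ∈ K, a * x ∈ P.1 := by
  obtain ⟨V, _, _, hV, hP⟩ := P.exists_simple
  have hK' : ∃ x ∈ K, ∃ v : V, x • v ≠ 0 := by
    simpa only [hP, not_forall] using hK
  simp only [hP, mul_smul]
  refine ⟨fun h x _ v => h _, fun h v => ?_⟩
  rcases eq_or_ne v 0 with rfl | hv
  · exact smul_zero a
  · obtain ⟨x, hx, hxv⟩ := exists_mem_smul_eq K hl hr hK' hv v
    rw [← hxv]
    exact h x hx v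

theorem PrimSpec.eq_of_forall_mem_iff {A : Type} [Ring A] {P P' : PrimSpec A} (K : AddSubgroup A)
    (hl : ∀ x ∈ K, ∀ a : A, a * x ∈ K) (hr : ∀ x ∈ K, ∀ a : A, x * a ∈ K)
    (hK : ∃ x ∈ K, x ∉ P.1) (h : ∀ x ∈ K, x ∈ P.1 ↔ x ∈ P'.1) : P = P' := by
  have hK' : ∃ x ∈ K, x ∉ P'.1 := by
    obtain ⟨x, hx, hxP⟩ := hK
    exact ⟨x, hx, fun hx' => hxP ((h x hx).2 hx')⟩
  refine Subtype.ext (Ideal.ext fun a => ?_)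
  rw [P.mem_iff_forall_mul_mem K hl hr hK, P'.mem_iff_forall_mul_mem K hl hr hK']
  exact forall₂_congr fun x hx => h _ (hl x hx a)

theorem NonUnitalAlgHom.exists_lift_of_surjective {k K Q E : Type} [CommRing k]
    [NonUnitalRing K] [Module k K] [NonUnitalRing Q] [Module k Q] [NonUnitalRing E] [Module k E]
    (p : K →ₙₐ[k] Q) (hp : Function.Surjective p) (f : K →ₙₐ[k] E)
    (hf : ∀ x, p x = 0 → f x = 0) : ∃ g : Q →ₙₐ[k] E, ∀ x, g (p x) = f x := by
  choose s hs using hp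
  have key : ∀ {x y}, p x = p y → f x = f y := fun {x y} h => by
    rw [← sub_eq_zero, ← map_sub]
    exact hf _ (by rw [map_sub, h, sub_self])
  exact ⟨{ toFun := fun q => f (s q)
           map_smul' := fun c q => by
            rw [← map_smul]
            exact key (by simp [hs])
           map_zero' := hf _ (hs 0)
           map_add' := fun q r => by
            rw [← map_add]
            exact key (by simp [hs])
           map_mul' := fun q r => by
            rw [← map_mul]
            exact key (by simp [hs]) }, fun x => key (hs _)⟩

section Unitization

variable {k A Q : Type} [CommRing k] [Ring A] [Algebra k A]
  [NonUnitalRing Q] [Module k Q]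

variable (k Q) in
/-- The augmentation ideal of the unitization. -/
def inrAddSubgroup : AddSubgroup (Unitization k Q) :=
  (Unitization.inrHom k k Q : Q →ₗ[k] Unitization k Q).toAddMonoidHom.range

theorem mul_mem_inrAddSubgroup (x : Unitization k Q) (hx : x ∈ inrAddSubgroup k Q)
    (a : Unitization k Q) : a * x ∈ inrAddSubgroup k Q := by
  obtain ⟨q, rfl⟩ := hx
  exact ⟨(a * (q : Unitization k Q)).snd, Unitization.ext (by simp) rfl⟩

theorem inrAddSubgroup_mul_mem (x : Unitization k Q) (hx : x ∈ inrAddSubgroup k Q)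
    (a : Unitization k Q) : x * a ∈ inrAddSubgroup k Q := by
  obtain ⟨q, rfl⟩ := hx
  exact ⟨((q : Unitization k Q) * a).snd, Unitization.ext (by simp) rfl⟩

variable [IsScalarTower k Q Q] [SMulCommClass k Q Q]

/-- Restriction of a primitive ideal of `A` to a subquotient `Q = K / ker p`. -/
theorem exists_primSpec_unitization (K : NonUnitalSubalgebra k A)
    (hl : ∀ x ∈ K, ∀ a : A, a * x ∈ K) (hr : ∀ x ∈ K, ∀ a : A, x * a ∈ K)
    (p : K →ₙₐ[k] Q) (hp : Function.Surjective p) (P : PrimSpec A)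
    (hker : ∀ x : K, p x = 0 → (x : A) ∈ P.1) (hK : ∃ x ∈ K, x ∉ P.1) :
    ∃ P' : PrimSpec (Unitization k Q),
      ∀ x : K, (p x : Unitization k Q) ∈ P'.1 ↔ (x : A) ∈ P.1 := by
  obtain ⟨V, _, _, hV, hP⟩ := P.exists_simple
  have := IsSimpleModule.nontrivial A V
  have hK' : ∃ x ∈ K.toAddSubgroup, ∃ v : V, x • v ≠ 0 := by
    obtain ⟨x, hx, hxP⟩ := hK
    rw [hP, not_forall] at hxP
    exact ⟨x, hx, hxP⟩
  let _ : Module k V := Module.compHom V (algebraMap k A)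
  have : IsScalarTower k A V := ⟨fun c a v => by
    rw [Algebra.smul_def, mul_smul]; rfl⟩
  have : SMulCommClass A k V := IsScalarTower.to_smulCommClass'
  obtain ⟨g, hg⟩ := NonUnitalAlgHom.exists_lift_of_surjective p hp
    (((Algebra.lsmul k k V : A →ₐ[k] Module.End k V) : A →ₙₐ[k] Module.End k V).comp
      (NonUnitalSubalgebraClass.subtype K))
    (fun x hx => LinearMap.ext fun v => (hP _).1 (hker x hx) v)
  have hg' : ∀ (x : K) (v : V), g (p x) v = (x : A) • v := fun x v => by rw [hg]; rfl
  let ρ : Unitization k Q →+* AddMonoid.End V :=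
    (Module.toAddMonoidEnd (Module.End k V) V).comp (Unitization.lift g).toRingHom
  have hρ : ∀ (x : K) (v : V), ρ (p x : Unitization k Q) v = (x : A) • v := fun x v => by
    rw [← hg']
    change (Unitization.lift g (p x : Unitization k Q)) v = _
    simp
  obtain ⟨P', hP'⟩ := exists_primSpec_of_transitive ρ fun v hv w => by
    obtain ⟨x, hx, hxv⟩ := exists_mem_smul_eq K.toAddSubgroup hl hr hK' hv w
    exact ⟨(p ⟨x, hx⟩ : Unitization k Q), (hρ _ v).trans hxv⟩
  exact ⟨P', fun x => by simp only [hP, hP', hρ]⟩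

/-- Extension of a primitive ideal of a subquotient `Q` of `A` to `A`. -/
theorem exists_primSpec_of_unitization (K : NonUnitalSubalgebra k A)
    (hl : ∀ x ∈ K, ∀ a : A, a * x ∈ K) (hr : ∀ x ∈ K, ∀ a : A, x * a ∈ K)
    (p : K →ₙₐ[k] Q) (hp : Function.Surjective p) (P' : PrimSpec (Unitization k Q))
    (hQ : ∃ q : Q, (q : Unitization k Q) ∉ P'.1) :
    ∃ P : PrimSpec A, ∀ x : K, (p x : Unitization k Q) ∈ P'.1 ↔ (x : A) ∈ P.1 := by
  obtain ⟨V, _, _, hV, hP⟩ := P'.exists_simple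
  have := IsSimpleModule.nontrivial (Unitization k Q) V
  have hQ' : ∃ x ∈ inrAddSubgroup k Q, ∃ v : V, x • v ≠ 0 := by
    obtain ⟨q, hq⟩ := hQ
    rw [hP, not_forall] at hq
    exact ⟨q, ⟨q, rfl⟩, hq⟩
  let act : K → V → V := fun x v => (p x : Unitization k Q) • v
  have act_mul : ∀ x y v, act (x * y) v = act x (act y v) := fun x y v => by
    simp [act, mul_smul]
  have trans : ∀ v : V, v ≠ 0 → ∀ w, ∃ x, act x v = w := fun v hv w => by
    obtain ⟨_, ⟨q, rfl⟩, h⟩ :=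
      exists_mem_smul_eq _ mul_mem_inrAddSubgroup inrAddSubgroup_mul_mem hQ' hv w
    obtain ⟨x, rfl⟩ := hp q
    exact ⟨x, h⟩
  have nondeg : ∀ v w : V, (∀ z, act z v = act z w) → v = w := fun v w h => by
    by_contra hvw
    obtain ⟨x, hx⟩ := trans (v - w) (sub_ne_zero.2 hvw) (v - w)
    refine hvw (sub_eq_zero.1 (hx.symm.trans ?_))
    simpa only [act, smul_sub, sub_eq_zero] using h x
  have exists_smul : ∀ (a : A) (w : V), ∃ u, ∀ z : K, act z u = act ⟨z * a, hr z z.2 a⟩ w := by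
    intro a w
    obtain ⟨v, hv⟩ := exists_ne (0 : V)
    obtain ⟨x, rfl⟩ := trans v hv w
    refine ⟨act ⟨a * x, hl x x.2 a⟩ v, fun z => ?_⟩
    rw [← act_mul, ← act_mul]
    congr 1
    exact Subtype.ext (mul_assoc _ _ _).symm
  choose σ hσ using exists_smul
  have hσK : ∀ (x : K) (v : V), σ x v = act x v := fun x v => nondeg _ _ fun z => by
    rw [hσ, ← act_mul]; rfl
  let ρ : A →+* AddMonoid.End V :=
    { toFun := fun a =>
        { toFun := σ a
          map_zero' := nondeg _ _ fun z => by rw [hσ]; simp [act]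
          map_add' := fun v w => nondeg _ _ fun z => by
            rw [hσ]
            simp only [act, smul_add]
            exact congrArg₂ (· + ·) (hσ a v z).symm (hσ a w z).symm }
      map_one' := AddMonoidHom.ext fun v => nondeg _ _ fun z => by
        change act z (σ 1 v) = act z v
        rw [hσ]
        simp only [mul_one]
      map_zero' := AddMonoidHom.ext fun v => nondeg _ _ fun z => by
        change act z (σ 0 v) = act z 0
        rw [hσ]
        have : (⟨z * 0, hr z z.2 0⟩ : K) = 0 := Subtype.ext (mul_zero _)
        rw [this]
        simp [act]
      map_mul' := fun a b => AddMonoidHom.ext fun v => nondeg _ _ fun z => by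
        change act z (σ (a * b) v) = act z (σ a (σ b v))
        rw [hσ, hσ, hσ]
        simp only [mul_assoc]
      map_add' := fun a b => AddMonoidHom.ext fun v => nondeg _ _ fun z => by
        change act z (σ (a + b) v) = act z (σ a v + σ b v)
        have hadd : act z (σ a v + σ b v) = act z (σ a v) + act z (σ b v) := smul_add _ _ _
        have : (⟨z * (a + b), hr z z.2 _⟩ : K) = ⟨z * a, hr z z.2 _⟩ + ⟨z * b, hr z z.2 _⟩ :=
          Subtype.ext (mul_add _ _ _)
        rw [hadd, hσ, hσ, hσ, this]
        simp only [act, map_add, Unitization.inr_add, add_smul] }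
  have hρ : ∀ (x : K) (v : V), ρ x v = (p x : Unitization k Q) • v := hσK
  obtain ⟨P, hP''⟩ := exists_primSpec_of_transitive ρ fun v hv w => by
    obtain ⟨x, hx⟩ := trans v hv w
    exact ⟨x, (hρ x v).trans hx⟩
  exact ⟨P, fun x => by simp only [hP, hP'', hρ]⟩

/-- The primitive ideals of `A` containing `K₀` but not `K` are those of the unitization of
`Q = K / K₀` not containing `Q`. -/
theorem nonempty_stratum_equiv (K₀ K : NonUnitalSubalgebra k A) (hle : K₀ ≤ K)
    (hts : ∀ x ∈ K, ∀ a : A, a * x ∈ K ∧ x * a ∈ K)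
    (p : K →ₙₐ[k] Q) (hp : Function.Surjective p) (hker : ∀ x : K, p x = 0 ↔ (x : A) ∈ K₀) :
    Nonempty ({P : PrimSpec A // (∀ x ∈ K₀, x ∈ P.1) ∧ ¬ ∀ x ∈ K, x ∈ P.1} ≃
      {P : PrimSpec (Unitization k Q) // ¬ ∀ q : Q, (q : Unitization k Q) ∈ P.1}) := by
  have hl : ∀ x ∈ K, ∀ a : A, a * x ∈ K := fun x hx a => (hts x hx a).1
  have hr : ∀ x ∈ K, ∀ a : A, x * a ∈ K := fun x hx a => (hts x hx a).2
  have hex : ∀ P : {P : PrimSpec A // (∀ x ∈ K₀, x ∈ P.1) ∧ ¬ ∀ x ∈ K, x ∈ P.1},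
      ∃ P' : {P : PrimSpec (Unitization k Q) // ¬ ∀ q : Q, (q : Unitization k Q) ∈ P.1},
        ∀ x : K, (p x : Unitization k Q) ∈ P'.1.1 ↔ (x : A) ∈ P.1.1 := by
    rintro ⟨P, h₀, hK⟩
    push Not at hK
    obtain ⟨P', hP'⟩ := exists_primSpec_unitization K hl hr p hp P
      (fun x hx => h₀ x ((hker x).1 hx)) hK
    obtain ⟨x, hx, hxP⟩ := hK
    exact ⟨⟨P', fun h => hxP ((hP' ⟨x, hx⟩).1 (h _))⟩, hP'⟩
  choose F hF using hex
  refine ⟨Equiv.ofBijective F ⟨fun P₁ P₂ h => ?_, fun P' => ?_⟩⟩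
  · have hK := P₁.2.2
    push Not at hK
    refine Subtype.ext (PrimSpec.eq_of_forall_mem_iff K.toAddSubgroup hl hr hK fun x hx => ?_)
    rw [← hF P₁ ⟨x, hx⟩, h, hF P₂ ⟨x, hx⟩]
  · obtain ⟨P', hQ⟩ := P'
    push Not at hQ
    obtain ⟨P, hP⟩ := exists_primSpec_of_unitization K hl hr p hp P' hQ
    have hPmem : (∀ x ∈ K₀, x ∈ P.1) ∧ ¬ ∀ x ∈ K, x ∈ P.1 := by
      refine ⟨fun x hx => (hP ⟨x, hle hx⟩).1 ?_, fun h => ?_⟩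
      · rw [(hker ⟨x, hle hx⟩).2 hx, Unitization.inr_zero]
        exact P'.1.zero_mem
      · obtain ⟨q, hq⟩ := hQ
        obtain ⟨x, rfl⟩ := hp q
        exact hq ((hP x).2 (h x x.2))
    refine ⟨⟨P, hPmem⟩, Subtype.ext (Eq.symm ?_)⟩
    refine PrimSpec.eq_of_forall_mem_iff (inrAddSubgroup k Q) mul_mem_inrAddSubgroup
      inrAddSubgroup_mul_mem ?_ ?_
    · obtain ⟨q, hq⟩ := hQ
      exact ⟨q, ⟨q, rfl⟩, hq⟩
    · rintro _ ⟨q, rfl⟩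
      obtain ⟨x, rfl⟩ := hp q
      exact (hP x).trans (hF ⟨P, hPmem⟩ x).symm

variable {R : Type} [NonUnitalRing R] [Module k R] [IsScalarTower k R R] [SMulCommClass k R R]

/-- A primitive ideal of the unitization of `Q` that contains `Q` has a counterpart in the
unitization of `R` with the same trace on `k`. -/
theorem exists_primSpec_fst_inl_mem (P : PrimSpec (Unitization k Q))
    (hQ : ∀ q : Q, (q : Unitization k Q) ∈ P.1) :
    ∃ P' : PrimSpec (Unitization k R),
      ∀ r, r ∈ P'.1 ↔ (Unitization.inl r.fst : Unitization k Q) ∈ P.1 := by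
  obtain ⟨V, _, _, hV, hP⟩ := P.exists_simple
  have := IsSimpleModule.nontrivial (Unitization k Q) V
  let ρ : Unitization k R →+* AddMonoid.End V :=
    (Module.toAddMonoidEnd (Unitization k Q) V).comp
      ((Unitization.inlRingHom k Q).comp (Unitization.fstHom k R).toRingHom)
  have hρ : ∀ r v, ρ r v = (Unitization.inl r.fst : Unitization k Q) • v := fun _ _ => rfl
  obtain ⟨P', hP'⟩ := exists_primSpec_of_transitive ρ fun v hv w => by
    obtain ⟨x, rfl⟩ := IsSimpleModule.toSpanSingleton_surjective (Unitization k Q) hv w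
    refine ⟨Unitization.inl x.fst, ?_⟩
    rw [hρ, Unitization.fst_inl, LinearMap.toSpanSingleton_apply]
    conv_rhs => rw [← Unitization.inl_fst_add_inr_snd_eq x, add_smul, (hP _).1 (hQ x.snd) v,
      add_zero]
  exact ⟨P', fun r => by simp only [hP, hP', hρ]⟩

theorem unitizationMap_apply (φ : Q →ₙₐ[k] R) (x : Unitization k Q) :
    unitizationMap k φ x = Unitization.inl x.fst + (φ x.snd : Unitization k R) := by
  rfl

theorem NUSpectrumPreserving.nonempty_equiv {φ : Q →ₙₐ[k] R} (hφ : NUSpectrumPreserving k φ) :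
    Nonempty ({P : PrimSpec (Unitization k R) // ¬ ∀ r : R, (r : Unitization k R) ∈ P.1} ≃
      {P : PrimSpec (Unitization k Q) // ¬ ∀ q : Q, (q : Unitization k Q) ∈ P.1}) := by
  obtain ⟨f, hf, hgraph⟩ := hφ
  have hgraph' : ∀ P Q, (∀ x, unitizationMap k φ x ∈ P.1 → x ∈ Q.1) ↔ f P = Q := hgraph
  refine ⟨(Equiv.ofBijective f hf).subtypeEquiv fun P => not_congr ⟨fun h q => ?_, fun h => ?_⟩⟩
  · refine (hgraph' P (f P)).2 rfl _ ?_
    rw [unitizationMap_apply]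
    simpa using h (φ q)
  · rw [Equiv.ofBijective_apply] at h
    obtain ⟨P', hP'⟩ := exists_primSpec_fst_inl_mem (R := R) (f P) h
    have hP : f P' = f P := (hgraph' P' (f P)).1 fun x hx => by
      rw [hP', unitizationMap_apply] at hx
      rw [← Unitization.inl_fst_add_inr_snd_eq x]
      exact add_mem (by simpa using hx) (h _)
    obtain rfl := hf.1 hP
    intro r
    rw [hP']
    simp

end Unitization

/-- A filtration by ideals partitions the primitive spectrum into strata. -/
theorem nonempty_sigma_stratum_equiv {k A : Type} [CommRing k] [Ring A] [Algebra k A] {n : ℕ}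
    (fil : Fin (n + 1) → NonUnitalSubalgebra k A) (hmono : Monotone fil)
    (h0 : fil 0 = ⊥) (htop : fil (Fin.last n) = ⊤) :
    Nonempty ((Σ i : Fin n, {P : PrimSpec A //
      (∀ x ∈ fil i.castSucc, x ∈ P.1) ∧ ¬ ∀ x ∈ fil i.succ, x ∈ P.1}) ≃ PrimSpec A) := by
  refine ⟨Equiv.ofBijective (fun s => s.2.1) ⟨?_, fun P => ?_⟩⟩
  · rintro ⟨i, P, hi, hi'⟩ ⟨j, P', hj, hj'⟩ (rfl : P = P')
    obtain rfl : i = j := by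
      rcases lt_trichotomy i j with h | h | h
      · exact absurd (fun x hx => hj x (hmono (Fin.succ_le_castSucc_iff.2 h) hx)) hi'
      · exact h
      · exact absurd (fun x hx => hi x (hmono (Fin.succ_le_castSucc_iff.2 h) hx)) hj'
    rfl
  · by_contra hP
    have hall : ∀ i, ∀ x ∈ fil i, x ∈ P.1 := by
      intro i
      induction i using Fin.induction with
      | zero =>
        intro x hx
        rw [h0, NonUnitalAlgebra.mem_bot] at hx
        exact hx ▸ P.1.zero_mem
      | succ i ih =>
        by_contra h
        exact hP ⟨⟨i, P, ih, h⟩, rfl⟩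
    refine P.one_notMem (hall (Fin.last n) 1 ?_)
    rw [htop]
    trivial

/-- If `φ : L → J` is a weakly spectrum preserving morphism of unital finite type
`k`-algebras — i.e. there are increasing filtrations `(0) = L₀ ⊆ … ⊆ Lₙ = L` and
`(0) = J₀ ⊆ … ⊆ Jₙ = J` by two-sided ideals with `φ(Lᵢ) ⊆ Jᵢ` such that each induced
morphism `Lᵢ/Lᵢ₋₁ → Jᵢ/Jᵢ₋₁` (the subquotients presented as surjective images `Qᵢ`,
`Rᵢ` with the indicated kernels) is spectrum preserving — then there is a bijection
`Prim(J) → Prim(L)`. -/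
theorem primSpec_bijection_of_weakly_spectrumPreserving
    (k : Type) [CommRing k] [Algebra ℂ k] [Algebra.FiniteType ℂ k]
    (L J : Type) [Ring L] [Ring J] [Algebra k L] [Algebra k J]
    [Module.Finite k L] [Module.Finite k J]
    (φ : L →ₙₐ[k] J) (n : ℕ)
    (Lfil : Fin (n + 1) → NonUnitalSubalgebra k L)
    (Jfil : Fin (n + 1) → NonUnitalSubalgebra k J)
    (hLmono : Monotone Lfil) (hJmono : Monotone Jfil)
    (hL0 : Lfil 0 = ⊥) (hLtop : Lfil (Fin.last n) = ⊤)
    (hJ0 : Jfil 0 = ⊥) (hJtop : Jfil (Fin.last n) = ⊤)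
    (hLts : ∀ i, ∀ x ∈ Lfil i, ∀ a : L, a * x ∈ Lfil i ∧ x * a ∈ Lfil i)
    (hJts : ∀ i, ∀ y ∈ Jfil i, ∀ a : J, a * y ∈ Jfil i ∧ y * a ∈ Jfil i)
    (hmap : ∀ i, ∀ x ∈ Lfil i, φ x ∈ Jfil i)
    (Q R : Fin n → Type)
    [∀ i, NonUnitalRing (Q i)] [∀ i, Module k (Q i)]
    [∀ i, IsScalarTower k (Q i) (Q i)] [∀ i, SMulCommClass k (Q i) (Q i)]
    [∀ i, NonUnitalRing (R i)] [∀ i, Module k (R i)]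
    [∀ i, IsScalarTower k (R i) (R i)] [∀ i, SMulCommClass k (R i) (R i)]
    (pL : ∀ i : Fin n, (Lfil i.succ) →ₙₐ[k] Q i)
    (pJ : ∀ i : Fin n, (Jfil i.succ) →ₙₐ[k] R i)
    (hpL : ∀ i, Function.Surjective (pL i))
    (hpJ : ∀ i, Function.Surjective (pJ i))
    (hkerL : ∀ i, ∀ x : Lfil i.succ, pL i x = 0 ↔ (x : L) ∈ Lfil i.castSucc)
    (hkerJ : ∀ i, ∀ y : Jfil i.succ, pJ i y = 0 ↔ (y : J) ∈ Jfil i.castSucc)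
    (φbar : ∀ i : Fin n, Q i →ₙₐ[k] R i)
    (hcomm : ∀ (i : Fin n) (x : Lfil i.succ),
      φbar i (pL i x) = pJ i ⟨φ (x : L), hmap i.succ (x : L) x.2⟩)
    (hsp : ∀ i, NUSpectrumPreserving k (φbar i)) :
    Nonempty (PrimSpec J ≃ PrimSpec L) := by
  obtain ⟨eJ⟩ := nonempty_sigma_stratum_equiv Jfil hJmono hJ0 hJtop
  obtain ⟨eL⟩ := nonempty_sigma_stratum_equiv Lfil hLmono hL0 hLtop
  have sL := fun i : Fin n => (nonempty_stratum_equiv _ _ (hLmono (Fin.castSucc_le_succ i))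
    (hLts i.succ) (pL i) (hpL i) (hkerL i)).some
  have sJ := fun i : Fin n => (nonempty_stratum_equiv _ _ (hJmono (Fin.castSucc_le_succ i))
    (hJts i.succ) (pJ i) (hpJ i) (hkerJ i)).some
  have e := fun i => (hsp i).nonempty_equiv.some
  exact ⟨eJ.symm.trans ((Equiv.sigmaCongrRight fun i =>
    (sJ i).trans ((e i).trans (sL i).symm)).trans eL)⟩
end
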